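/- Let A be a commutative algebra over ℂ, let X and Y be derivations of A that commute (⁅X,Y⁆ = 0 as linear maps), assume Y is locally nilpotent (for every β ∈ A there is N with Yᴺ(β) = 0), and fix a scalar t ∈ ℂ. Define α⋆β := Σ_{n≥0} (tⁿ/n!)·Xⁿ(α)·Yⁿ(β) (a finite sum for each pair α, β). Then ⋆ is a ℂ-bilinear, associative product on A with unit 1: (α⋆β)⋆γ = α⋆(β⋆γ) and 1⋆α = α⋆1 = α for all α, β, γ ∈ A. -/

import Mathlib

open scoped BigOperators

theorem Finset.sum_range_sum_antidiagonal_of_eq_zero {M : Type*} [AddCommMonoid M] (K : ℕ)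
    (f : ℕ → ℕ → M) (hf : ∀ i j, K ≤ i + j → f i j = 0) :
    ∑ m ∈ Finset.range K, ∑ p ∈ Finset.HasAntidiagonal.antidiagonal m, f p.1 p.2 =
      ∑ i ∈ Finset.range K, ∑ j ∈ Finset.range K, f i j := by
  rw [← Finset.sum_product', Finset.sum_sigma']
  refine Finset.sum_of_injOn (fun x => x.2) ?_ ?_ ?_ ?_
  · rintro ⟨m, p⟩ h ⟨m', p'⟩ h' heq
    simp only [Finset.coe_sigma, Set.mem_sigma_iff, Finset.mem_coe,
      Finset.HasAntidiagonal.mem_antidiagonal] at h h'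
    obtain rfl : p = p' := heq
    obtain rfl : m = m' := h.2.symm.trans h'.2
    rfl
  · rintro ⟨m, p⟩ h
    simp only [Finset.coe_sigma, Set.mem_sigma_iff, Finset.mem_coe,
      Finset.HasAntidiagonal.mem_antidiagonal, Finset.mem_range, Finset.mem_product] at h ⊢
    omega
  · rintro ⟨i, j⟩ - h
    refine hf i j (not_lt.1 fun hlt => h ⟨⟨i + j, (i, j)⟩, ?_, rfl⟩)
    simpa using hlt
  · intros
    rfl

namespace Derivation

variable {A : Type*} [CommRing A] [Algebra ℂ A]

theorem toLinearMap_pow_apply_mul (D : Derivation ℂ A A) (n : ℕ) (a b : A) :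
    (D.toLinearMap ^ n) (a * b) = ∑ p ∈ Finset.HasAntidiagonal.antidiagonal n,
      n.choose p.1 • ((D.toLinearMap ^ p.1) a * (D.toLinearMap ^ p.2) b) := by
  induction n with
  | zero => simp
  | succ n ih =>
    rw [Finset.sum_antidiagonal_choose_succ_nsmul
      (fun i j => (D.toLinearMap ^ i) a * (D.toLinearMap ^ j) b) n, pow_succ',
      Module.End.mul_apply, ih, map_sum, ← Finset.sum_add_distrib]
    refine Finset.sum_congr rfl fun ⟨i, j⟩ hij => ?_
    rw [← n.choose_symm_of_eq_add (Finset.HasAntidiagonal.mem_antidiagonal.1 hij).symm, map_nsmul, ← smul_add]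
    congr 1
    simp only [pow_succ', Module.End.mul_apply,
      coeFn_coe, leibniz, smul_eq_mul]
    ring

theorem div_factorial_smul_pow_apply_mul (D : Derivation ℂ A A) (c : ℂ) (n : ℕ) (a b : A) :
    (c / n.factorial) • (D.toLinearMap ^ n) (a * b) = ∑ p ∈ Finset.HasAntidiagonal.antidiagonal n,
      (c / (p.1.factorial * p.2.factorial)) •
        ((D.toLinearMap ^ p.1) a * (D.toLinearMap ^ p.2) b) := by
  rw [toLinearMap_pow_apply_mul, Finset.smul_sum]
  refine Finset.sum_congr rfl fun p hp => ?_
  obtain rfl := Finset.HasAntidiagonal.mem_antidiagonal.1 hp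
  rw [← Nat.cast_smul_eq_nsmul ℂ, smul_smul, Nat.cast_add_choose]
  congr 1
  have := Nat.cast_ne_zero (R := ℂ).2 (p.1 + p.2).factorial_ne_zero
  field_simp

theorem toLinearMap_pow_apply_one (D : Derivation ℂ A A) {n : ℕ} (hn : n ≠ 0) :
    (D.toLinearMap ^ n) 1 = 0 := by
  obtain ⟨k, rfl⟩ := Nat.exists_eq_succ_of_ne_zero hn
  simp [pow_succ]

end Derivation

/-- Let `A` be a commutative `ℂ`-algebra, `X, Y` commuting derivations of `A`
with `Y` locally nilpotent, and `t ∈ ℂ`. Then the star product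
`α ⋆ β := Σ_{n≥0} (tⁿ/n!)·Xⁿ(α)·Yⁿ(β)` (a finite sum) is `ℂ`-bilinear,
associative, and unital with unit `1`. -/
theorem statement7 {A : Type*} [CommRing A] [Algebra ℂ A]
    (X Y : Derivation ℂ A A)
    (hcomm : X.toLinearMap ∘ₗ Y.toLinearMap = Y.toLinearMap ∘ₗ X.toLinearMap)
    (hnil : ∀ β : A, ∃ N : ℕ, (Y.toLinearMap ^ N) β = 0)
    (t : ℂ)
    (st : A → A → A)
    (hst : ∀ α β : A, st α β =
      ∑ᶠ n : ℕ, ((t ^ n / n.factorial : ℂ)) •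
        ((X.toLinearMap ^ n) α * ((Y.toLinearMap ^ n) β))) :
    (∀ (a : ℂ) (α α' β : A), st (a • α + α') β = a • st α β + st α' β) ∧
    (∀ (a : ℂ) (α β β' : A), st α (a • β + β') = a • st α β + st α β') ∧
    (∀ α β γ : A, st (st α β) γ = st α (st β γ)) ∧
    (∀ α : A, st 1 α = α ∧ st α 1 = α) := by
  have hY : ∀ {β : A} {N n : ℕ}, (Y.toLinearMap ^ N) β = 0 → N ≤ n →
      (Y.toLinearMap ^ n) β = 0 := fun {β N n} h hn => by
    rw [← Nat.sub_add_cancel hn, pow_add, Module.End.mul_apply, h, map_zero]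
  have hXY : ∀ (i j : ℕ) (β : A), (X.toLinearMap ^ i) ((Y.toLinearMap ^ j) β) =
      (Y.toLinearMap ^ j) ((X.toLinearMap ^ i) β) := fun i j β =>
    LinearMap.congr_fun ((show Commute X.toLinearMap Y.toLinearMap from hcomm).pow_pow i j).eq β
  have hsum : ∀ {α β : A} {N : ℕ} (K : ℕ), (Y.toLinearMap ^ N) β = 0 → N ≤ K →
      st α β = ∑ n ∈ Finset.range K, ((t ^ n / n.factorial : ℂ)) •
        ((X.toLinearMap ^ n) α * ((Y.toLinearMap ^ n) β)) := fun {α β N} K h hK => by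
    rw [hst]
    refine finsum_eq_sum_of_support_subset _ fun n hn => ?_
    by_contra hn'
    refine hn ?_
    simp only [Finset.coe_range, Set.mem_Iio, not_lt] at hn'
    simp only [hY h (hK.trans hn'), mul_zero, smul_zero]
  refine ⟨fun a α α' β => ?_, fun a α β β' => ?_, fun α β γ => ?_, fun α => ⟨?_, ?_⟩⟩
  · obtain ⟨N, hN⟩ := hnil β
    simp only [hsum N hN le_rfl, Finset.smul_sum, ← Finset.sum_add_distrib]
    refine Finset.sum_congr rfl fun n _ => ?_
    rw [map_add, map_smul, add_mul, smul_add, smul_mul_assoc, smul_comm]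
  · obtain ⟨N, hN⟩ := hnil β
    obtain ⟨N', hN'⟩ := hnil β'
    have h : (Y.toLinearMap ^ (N + N')) (a • β + β') = 0 := by
      rw [map_add, map_smul, hY hN (by omega), hY hN' (by omega), smul_zero, add_zero]
    rw [hsum (N + N') h le_rfl, hsum (N + N') hN (by omega), hsum (N + N') hN' (by omega),
      Finset.smul_sum, ← Finset.sum_add_distrib]
    refine Finset.sum_congr rfl fun n _ => ?_
    rw [map_add, map_smul, mul_add, smul_add, mul_smul_comm, smul_comm]
  · obtain ⟨N, hN⟩ := hnil β
    obtain ⟨N', hN'⟩ := hnil γ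
    obtain ⟨M, hM⟩ := hnil (st β γ)
    obtain ⟨K, hK⟩ : ∃ K, K = N + N' + M := ⟨_, rfl⟩
    let F : ℕ → ℕ → ℕ → A := fun k i j =>
      (t ^ (k + i + j) / (k.factorial * i.factorial * j.factorial) : ℂ) •
        ((X.toLinearMap ^ (k + i)) α * ((Y.toLinearMap ^ k) ((X.toLinearMap ^ j) β) *
          (Y.toLinearMap ^ (i + j)) γ))
    have hF₁ : ∀ k i j, K ≤ i + j → F k i j = 0 := fun k i j h => by
      simp only [F, hY hN' (show N' ≤ i + j by omega), mul_zero, smul_zero]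
    have hF₂ : ∀ k i j, K ≤ k + i → F k i j = 0 := fun k i j h => by
      rcases le_total N k with hk | hk
      · simp only [F, ← hXY, hY hN hk, map_zero, zero_mul, mul_zero, smul_zero]
      · simp only [F, hY hN' (show N' ≤ i + j by omega), mul_zero, smul_zero]
    have hl : st (st α β) γ = ∑ k ∈ Finset.range K, ∑ i ∈ Finset.range K,
        ∑ j ∈ Finset.range K, F k i j := by
      simp_rw [← Finset.sum_range_sum_antidiagonal_of_eq_zero K _ (hF₁ _)]
      rw [Finset.sum_comm, hsum K hN' (by omega), hsum K hN (by omega)]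
      refine Finset.sum_congr rfl fun m _ => ?_
      rw [← smul_mul_assoc, map_sum, Finset.smul_sum, Finset.sum_mul]
      refine Finset.sum_congr rfl fun k _ => ?_
      rw [map_smul, smul_comm, X.div_factorial_smul_pow_apply_mul, Finset.smul_sum,
        Finset.sum_mul]
      refine Finset.sum_congr rfl fun p hp => ?_
      obtain rfl := Finset.HasAntidiagonal.mem_antidiagonal.1 hp
      simp only [F]
      rw [smul_smul, smul_mul_assoc, ← Module.End.mul_apply, ← pow_add, hXY, add_comm p.1 k,
        mul_assoc]
      congr 1
      rw [div_mul_div_comm, ← pow_add, add_assoc, mul_assoc]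
    have hr : st α (st β γ) = ∑ j ∈ Finset.range K, ∑ k ∈ Finset.range K,
        ∑ i ∈ Finset.range K, F k i j := by
      simp_rw [← Finset.sum_range_sum_antidiagonal_of_eq_zero K (fun k i => F k i _)
        (fun k i => hF₂ k i _)]
      rw [Finset.sum_comm, hsum K hM (by omega), hsum K hN' (by omega)]
      refine Finset.sum_congr rfl fun m _ => ?_
      rw [← mul_smul_comm, map_sum, Finset.smul_sum, Finset.mul_sum]
      refine Finset.sum_congr rfl fun j _ => ?_
      rw [map_smul, smul_comm, Y.div_factorial_smul_pow_apply_mul, Finset.smul_sum,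
        Finset.mul_sum]
      refine Finset.sum_congr rfl fun p hp => ?_
      obtain rfl := Finset.HasAntidiagonal.mem_antidiagonal.1 hp
      simp only [F]
      rw [smul_smul, mul_smul_comm, ← Module.End.mul_apply (_ ^ p.2), ← pow_add]
      congr 1
      rw [div_mul_div_comm, ← pow_add, add_comm j, mul_comm (j.factorial : ℂ)]
    rw [hl, hr, Finset.sum_comm (s := Finset.range K)
      (f := fun j k => ∑ i ∈ Finset.range K, F k i j)]
    exact Finset.sum_congr rfl fun k _ => Finset.sum_comm
  · rw [hst, finsum_eq_single _ 0 fun n hn => by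
      rw [X.toLinearMap_pow_apply_one hn, zero_mul, smul_zero]]
    simp
  · rw [hst, finsum_eq_single _ 0 fun n hn => by
      rw [Y.toLinearMap_pow_apply_one hn, mul_zero, smul_zero]]
    simp
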